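/- arXiv:2004.10037 — 7 statements merged into one kernel-verified Lean document; each statement's English description precedes it below -/
import Mathlib

section
/- Let a, c, b : ℝ with c ≠ 0, representing one dimension of a LineaRE relation (the line a·h + b = c·t in the (h, t)-plane). Then the relation dimension is symmetric — i.e. for all h, t : ℝ, a·h + b = c·t implies a·t + b = c·h — if and only if either a = -c, or (a = c and b = 0). -/
/-- One dimension `a·h + b = c·t` (with `c ≠ 0`) of a LineaRE relation is symmetric
iff `a = -c`, or `a = c` and `b = 0`. -/
theorem lineaRE_dim_symmetric_iff (a c b : ℝ) (hc : c ≠ 0) :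
    (∀ h t : ℝ, a * h + b = c * t → a * t + b = c * h) ↔
      a = -c ∨ (a = c ∧ b = 0) := by
  constructor
  · intro hsymm
    have h₀ : b * (a + c) = 0 := by
      have h := hsymm 0 (b / c) (by field_simp; ring)
      field_simp at h
      linarith
    have h₁ : (a - c) * (a + c) = 0 := by
      have h := hsymm 1 ((a + b) / c) (by field_simp)
      field_simp at h
      linarith
    by_cases hac : a + c = 0
    · exact Or.inl (eq_neg_of_add_eq_zero_left hac)
    · exact Or.inr ⟨sub_eq_zero.mp ((mul_eq_zero.mp h₁).resolve_right hac),
        (mul_eq_zero.mp h₀).resolve_right hac⟩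
  · rintro (rfl | ⟨rfl, rfl⟩) h t hht <;> linarith
end

section
/- Let k be a positive integer and let w1, w2, b : Fin k → ℝ with w2 i ≠ 0 for every index i, where ∘ denotes the Hadamard (componentwise) product. Then the relation is symmetric — i.e. for all h, t : Fin k → ℝ, w1 ∘ h + b = w2 ∘ t implies w1 ∘ t + b = w2 ∘ h — if and only if for every index i, either w1 i = -(w2 i), or (w1 i = w2 i and b i = 0). -/
/-- A LineaRE relation with all tail weights nonzero is symmetric iff, in every
dimension, either `w1 i = -(w2 i)` or (`w1 i = w2 i` and `b i = 0`). -/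
theorem lineaRE_symmetric_iff (k : ℕ) (hk : 0 < k) (w1 w2 b : Fin k → ℝ)
    (hw2 : ∀ i, w2 i ≠ 0) :
    (∀ h t : Fin k → ℝ, w1 * h + b = w2 * t → w1 * t + b = w2 * h) ↔
      ∀ i, w1 i = -(w2 i) ∨ (w1 i = w2 i ∧ b i = 0) := by
  constructor
  · intro hsymm i
    have key (c : ℝ) : w1 i * ((w1 i * c + b i) / w2 i) + b i = w2 i * c := by
      refine congrFun (hsymm (fun _ => c) (fun j => (w1 j * c + b j) / w2 j) ?_) i
      funext j
      exact (mul_div_cancel₀ _ (hw2 j)).symm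
    have h0 := key 0
    have h1 := key 1
    have hi := hw2 i
    field_simp at h0 h1
    have hb : (w1 i + w2 i) * b i = 0 := by linear_combination h0
    have hw : (w1 i + w2 i) * (w1 i - w2 i) = 0 := by linear_combination h1 - h0
    by_cases hs : w1 i + w2 i = 0
    · exact Or.inl (eq_neg_of_add_eq_zero_left hs)
    · exact Or.inr ⟨sub_eq_zero.mp ((mul_eq_zero.mp hw).resolve_left hs),
        (mul_eq_zero.mp hb).resolve_left hs⟩
  · intro hw h t hht
    funext i
    have hi : w1 i * h i + b i = w2 i * t i := congrFun hht i
    change w1 i * t i + b i = w2 i * h i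
    rcases hw i with hneg | ⟨heq, hb⟩
    · rw [hneg] at hi ⊢
      linear_combination hi
    · rw [heq, hb] at hi ⊢
      linear_combination -hi
end

section
/- Let a, c, b : ℝ with c ≠ 0. If a ≠ -c and (a ≠ c or b ≠ 0), then the relation dimension given by a·h + b = c·t is not symmetric: there exist real numbers h and t such that a·h + b = c·t but a·t + b ≠ c·h. Hence LineaRE can model antisymmetric relations. -/
/-- Antisymmetry pattern, one-dimensional case: if `a ≠ -c` and (`a ≠ c` or `b ≠ 0`),
then the relation dimension `a·h + b = c·t` is not symmetric. -/
theorem lineaRE_dim_not_symmetric (a c b : ℝ) (hc : c ≠ 0)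
    (h1 : a ≠ -c) (h2 : a ≠ c ∨ b ≠ 0) :
    ∃ h t : ℝ, a * h + b = c * t ∧ a * t + b ≠ c * h := by
  obtain ⟨h, hh⟩ : ∃ h : ℝ, (a - c) * h + b ≠ 0 := by
    by_cases hb : b = 0
    · exact ⟨1, by simpa [hb, sub_eq_zero] using h2⟩
    · exact ⟨0, by simpa using hb⟩
  have ht : c * ((a * h + b) / c) = a * h + b := mul_div_cancel₀ _ hc
  refine ⟨h, (a * h + b) / c, ht.symm, fun hswap => ?_⟩
  have hprod : (a + c) * ((a - c) * h + b) = 0 := by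
    linear_combination c * hswap - a * ht
  exact mul_ne_zero (fun h0 => h1 (eq_neg_of_add_eq_zero_left h0)) hh hprod
end

section
/- Let k be a positive integer and let w1, w2, b : Fin k → ℝ with w2 j ≠ 0 for every index j, where ∘ denotes the Hadamard (componentwise) product. If there exists an index i such that w1 i ≠ -(w2 i) and (w1 i ≠ w2 i or b i ≠ 0), then the relation is not symmetric: there exist h, t : Fin k → ℝ with w1 ∘ h + b = w2 ∘ t but w1 ∘ t + b ≠ w2 ∘ h. -/
/-- Antisymmetry pattern: if some dimension `i` has `w1 i ≠ -(w2 i)` and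
(`w1 i ≠ w2 i` or `b i ≠ 0`), then the LineaRE relation is not symmetric. -/
theorem lineaRE_not_symmetric (k : ℕ) (hk : 0 < k) (w1 w2 b : Fin k → ℝ)
    (hw2 : ∀ j, w2 j ≠ 0)
    (hi : ∃ i, w1 i ≠ -(w2 i) ∧ (w1 i ≠ w2 i ∨ b i ≠ 0)) :
    ∃ h t : Fin k → ℝ, w1 * h + b = w2 * t ∧ w1 * t + b ≠ w2 * h := by
  obtain ⟨i, hne, hor⟩ := hi
  obtain ⟨c, hc⟩ : ∃ c : ℝ, (w1 i - w2 i) * c + b i ≠ 0 := by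
    by_cases hb : b i = 0
    · exact ⟨1, by simpa [hb, sub_eq_zero] using hor⟩
    · exact ⟨0, by simpa using hb⟩
  refine ⟨fun _ => c, fun j => (w1 j * c + b j) / w2 j, ?_, fun heq => ?_⟩
  · funext j
    exact (mul_div_cancel₀ _ (hw2 j)).symm
  · have hw := hw2 i
    have hi := congrFun heq i
    simp only [Pi.add_apply, Pi.mul_apply] at hi
    field_simp at hi
    refine mul_ne_zero (fun h => hne (eq_neg_of_add_eq_zero_left h)) hc ?_
    linear_combination hi
end

section
/- Let a1, c1, b1, a2, c2, b2 : ℝ with c1 ≠ 0 and a2 ≠ 0. Then relation dimension r2 is the inverse of relation dimension r1 — i.e. for all h, t : ℝ, a1·h + b1 = c1·t holds if and only if a2·t + b2 = c2·h holds — if and only if a1·a2 = c1·c2 and a2·b1 + c1·b2 = 0. -/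
/-- Inversion pattern, one-dimensional case: with `c1 ≠ 0` and `a2 ≠ 0`, relation
dimension `r2` is the inverse of `r1` iff `a1·a2 = c1·c2` and `a2·b1 + c1·b2 = 0`. -/
theorem lineaRE_dim_inverse_iff (a1 c1 b1 a2 c2 b2 : ℝ) (hc1 : c1 ≠ 0) (ha2 : a2 ≠ 0) :
    (∀ h t : ℝ, a1 * h + b1 = c1 * t ↔ a2 * t + b2 = c2 * h) ↔
      (a1 * a2 = c1 * c2 ∧ a2 * b1 + c1 * b2 = 0) := by
  constructor
  · intro H
    have key (h : ℝ) : a2 * (a1 * h + b1) + c1 * b2 = c1 * c2 * h := by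
      have e : a1 * h + b1 = c1 * ((a1 * h + b1) / c1) := (mul_div_cancel₀ _ hc1).symm
      linear_combination a2 * e + c1 * (H h _).1 e
    have h0 := key 0
    have h1 := key 1
    exact ⟨by linear_combination h1 - h0, by linear_combination h0⟩
  · rintro ⟨hac, hb⟩ h t
    constructor
    · intro e
      apply mul_left_cancel₀ hc1
      linear_combination hb + h * hac - a2 * e
    · intro e
      apply mul_left_cancel₀ ha2
      linear_combination hb + h * hac - c1 * e
end

section
/- Let k be a positive integer and let a1, c1, b1, a2, c2, b2 : Fin k → ℝ, where ∘ denotes the Hadamard (componentwise) product, with c1 i ≠ 0 for every index i. If a1 ∘ a2 = c1 ∘ c2 and a2 ∘ b1 + c1 ∘ b2 = 0, then relation r2 is implied by the inverse of relation r1: for all h, t : Fin k → ℝ, a1 ∘ h + b1 = c1 ∘ t implies a2 ∘ t + b2 = c2 ∘ h. -/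
/-- Inversion pattern: if `a1 ∘ a2 = c1 ∘ c2` and `a2 ∘ b1 + c1 ∘ b2 = 0` (with all
`c1 i ≠ 0`), then whenever `(h, t)` satisfies relation `r1`, the pair `(t, h)`
satisfies relation `r2`. -/
theorem lineaRE_inverse (k : ℕ) (hk : 0 < k)
    (a1 c1 b1 a2 c2 b2 : Fin k → ℝ) (hc1 : ∀ i, c1 i ≠ 0)
    (hslope : a1 * a2 = c1 * c2) (hb : a2 * b1 + c1 * b2 = 0) :
    ∀ h t : Fin k → ℝ, a1 * h + b1 = c1 * t → a2 * t + b2 = c2 * h := by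
  intro h t hr
  ext i
  have hslope_i := congrFun hslope i
  have hb_i := congrFun hb i
  have hr_i := congrFun hr i
  simp only [Pi.mul_apply, Pi.add_apply, Pi.zero_apply] at hslope_i hb_i hr_i ⊢
  apply mul_left_cancel₀ (hc1 i)
  linear_combination hb_i - a2 i * hr_i + h i * hslope_i
end

section
/- Let a1, c1, b1, a2, c2, b2, a3, c3, b3 : ℝ with c2 ≠ 0, c3 ≠ 0, and c1 = c2·c3. Then the composition property holds — i.e. for all h, e, t : ℝ, (a2·h + b2 = c2·e and a3·e + b3 = c3·t) implies a1·h + b1 = c1·t — if and only if a1 = a2·a3 and b1 = b2·a3 + b3·c2. -/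
/-- Composition pattern, one-dimensional characterization: with `c2 ≠ 0`, `c3 ≠ 0`
and `c1 = c2·c3`, the composition property holds iff `a1 = a2·a3` and
`b1 = b2·a3 + b3·c2`. -/
theorem lineaRE_dim_composition_iff (a1 c1 b1 a2 c2 b2 a3 c3 b3 : ℝ)
    (hc2 : c2 ≠ 0) (hc3 : c3 ≠ 0) (hc1 : c1 = c2 * c3) :
    (∀ h e t : ℝ,
        a2 * h + b2 = c2 * e → a3 * e + b3 = c3 * t → a1 * h + b1 = c1 * t) ↔
      (a1 = a2 * a3 ∧ b1 = b2 * a3 + b3 * c2) := by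
  subst hc1
  constructor
  · intro H
    have key : ∀ h : ℝ, a1 * h + b1 = a3 * (a2 * h + b2) + c2 * b3 := by
      intro h
      have he : a2 * h + b2 = c2 * ((a2 * h + b2) / c2) := by field_simp
      have ht : a3 * ((a2 * h + b2) / c2) + b3
          = c3 * ((a3 * ((a2 * h + b2) / c2) + b3) / c3) := by field_simp
      linear_combination H h _ _ he ht - c2 * ht - a3 * he
    have h0 := key 0
    have h1 := key 1
    constructor
    · linear_combination h1 - h0
    · linear_combination h0
  · rintro ⟨rfl, rfl⟩ h e t he ht
    linear_combination a3 * he + c2 * ht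
end
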